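/- Proposition 1 (second claim, σ-algebra ℱ_t): Fix t ≥ 0 and let A : Ω → [0,∞) be ℱ_t-measurable. Then there exists a 𝒟⊗𝒟-measurable function H : D×D → [0,∞) such that A(ω) = H(X_·(ω), Z_·(ω)) for P-a.s. ω, such that for P-a.s. ω̃ ∈ Ω held fixed the map ω ↦ H(X_·(ω̃), Z_·(ω)) is ℱ^Z_t-measurable, and such that for P-a.s. ω̃ ∈ Ω held fixed the map ω ↦ H(X_·(ω), Z_·(ω̃)) is ℱ^X_{Z_t(ω̃)}-measurable. -/

import Mathlib

open MeasureTheory Filter Topology Set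
open scoped NNReal ENNReal

noncomputable section

/-- A real-valued function on `ℝ≥0` is càdlàg: right-continuous with left limits. -/
def IsCadlag (u : ℝ≥0 → ℝ) : Prop :=
  (∀ t : ℝ≥0, ContinuousWithinAt u (Set.Ici t) t) ∧
  (∀ t : ℝ≥0, 0 < t → ∃ l : ℝ, Tendsto u (𝓝[<] t) (𝓝 l))

/-- `D`, the space of real-valued càdlàg functions on `ℝ≥0`. -/
def D : Type := {u : ℝ≥0 → ℝ // IsCadlag u}

/-- The σ-algebra `𝒟` on `D` generated by the evaluation maps `u ↦ u s`. -/
instance : MeasurableSpace D :=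
  ⨆ s : ℝ≥0, MeasurableSpace.comap (fun u : D => u.1 s) inferInstance

variable {Ω : Type*} {E : Type*}

/-- The σ-algebra generated by the `μ`-null sets (used for the augmentation `·^P`). -/
def nullSets [MeasurableSpace Ω] (μ : Measure Ω) : MeasurableSpace Ω :=
  MeasurableSpace.generateFrom {s : Set Ω | μ s = 0}

/-- The raw canonical filtration `σ(Y_s : s ≤ t)` of a process `Y`. -/
def natF [MeasurableSpace E] (Y : ℝ≥0 → Ω → E) (t : ℝ≥0) : MeasurableSpace Ω :=
  ⨆ s ∈ Set.Iic t, MeasurableSpace.comap (Y s) inferInstance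

/-- `ℱ^Y_t`: the right-continuous `P`-completed canonical filtration of `Y`. -/
def rcF [MeasurableSpace Ω] [MeasurableSpace E] (μ : Measure Ω) (Y : ℝ≥0 → Ω → E)
    (t : ℝ≥0) : MeasurableSpace Ω :=
  ⨅ u ∈ Set.Ioi t, (natF Y u ⊔ nullSets μ)

/-- `ℱ^Y_∞ := σ(⋃ t, ℱ^Y_t)`. -/
def rcFinf [MeasurableSpace Ω] [MeasurableSpace E] (μ : Measure Ω) (Y : ℝ≥0 → Ω → E) :
    MeasurableSpace Ω :=
  ⨆ t : ℝ≥0, rcF μ Y t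

/-- The σ-algebra generated by the whole process `Y`. -/
def sigmaProc [MeasurableSpace E] (Y : ℝ≥0 → Ω → E) : MeasurableSpace Ω :=
  ⨆ s : ℝ≥0, MeasurableSpace.comap (Y s) inferInstance

/-- `ℋ_t := (ℱ^X_∞ ∨ ℱ^Z_t)^P`. -/
def Hfilt [MeasurableSpace Ω] (μ : Measure Ω) (X : ℝ≥0 → Ω → ℝ) (Z : ℝ≥0 → Ω → ℝ≥0)
    (t : ℝ≥0) : MeasurableSpace Ω :=
  (rcFinf μ X ⊔ rcF μ Z t) ⊔ nullSets μ

/-- `ℱ_t := (ℱ^{X_Z}_t ∨ ℱ^Z_t)^P`, where `(X_Z)_t ω := X (Z t ω) ω`. -/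
def Ffilt [MeasurableSpace Ω] (μ : Measure Ω) (X : ℝ≥0 → Ω → ℝ) (Z : ℝ≥0 → Ω → ℝ≥0)
    (t : ℝ≥0) : MeasurableSpace Ω :=
  (rcF μ (fun u ω => X (Z u ω) ω) t ⊔ rcF μ Z t) ⊔ nullSets μ

lemma nullSets_le_eventuallyMeasurableSpace (m : MeasurableSpace Ω) [MeasurableSpace Ω]
    (μ : Measure Ω) : nullSets μ ≤ eventuallyMeasurableSpace m (ae μ) :=
  @MeasurableSpace.generateFrom_le _ _ (eventuallyMeasurableSpace m (ae μ)) fun _ hs =>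
    ⟨∅, @MeasurableSet.empty _ m, ae_eq_empty.2 hs⟩

lemma natF_le_iff [MeasurableSpace E] {Y : ℝ≥0 → Ω → E} {u : ℝ≥0}
    {m : MeasurableSpace Ω} : natF Y u ≤ m ↔ ∀ s ≤ u, Measurable[m] (Y s) := by
  simp only [natF, iSup_le_iff, Set.mem_Iic, measurable_iff_comap_le]

lemma natF_mono [MeasurableSpace E] (Y : ℝ≥0 → Ω → E) : Monotone (natF Y) := fun _ _ h =>
  natF_le_iff.2 fun s hs => natF_le_iff.1 le_rfl s (hs.trans h)

lemma natF_eq_comap [MeasurableSpace E] (Y : ℝ≥0 → Ω → E) (u : ℝ≥0) :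
    natF Y u = (natF (fun s (w : ℝ≥0 → E) => w s) u).comap fun ω s => Y s ω := by
  simp only [natF, MeasurableSpace.comap_iSup, MeasurableSpace.comap_comp, Function.comp_def]

/-- The right-continuous canonical σ-algebra at time `t` on path space. -/
def pathF (E : Type*) [MeasurableSpace E] (t : ℝ≥0) : MeasurableSpace (ℝ≥0 → E) :=
  ⨅ u ∈ Set.Ioi t, natF (fun s (w : ℝ≥0 → E) => w s) u

lemma measurable_pathF [MeasurableSpace E] {Y : ℝ≥0 → Ω → E} {t u : ℝ≥0} (htu : t < u)
    {m : MeasurableSpace Ω} (h : ∀ s ≤ u, Measurable[m] (Y s)) :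
    Measurable[m, pathF E t] fun ω s => Y s ω := by
  rw [measurable_iff_comap_le]
  refine (MeasurableSpace.comap_mono (iInf₂_le u htu)).trans ?_
  rw [← natF_eq_comap]
  exact natF_le_iff.2 h

lemma measurable_rcF_of_forall_lt [MeasurableSpace Ω] [MeasurableSpace E] {β : Type*}
    {mβ : MeasurableSpace β} {μ : Measure Ω} {Y : ℝ≥0 → Ω → E} {t : ℝ≥0} {f : Ω → β}
    (h : ∀ u > t, Measurable[natF Y u] f) : Measurable[rcF μ Y t] f := by
  rw [measurable_iff_comap_le]
  exact le_iInf₂ fun u hu => (measurable_iff_comap_le.1 (h u hu)).trans le_sup_left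

/-- Events of the augmented right-continuous filtration are, up to null sets, path events that are
measurable for the right-continuous canonical filtration on path space. -/
lemma exists_pathF_of_rcF [MeasurableSpace Ω] [MeasurableSpace E] {μ : Measure Ω}
    {Y : ℝ≥0 → Ω → E} {t : ℝ≥0} {B : Set Ω} (hB : MeasurableSet[rcF μ Y t] B) :
    ∃ C, MeasurableSet[pathF E t] C ∧ B =ᵐ[μ] (fun ω s => Y s ω) ⁻¹' C := by
  obtain ⟨u, hu_anti, hu_gt, hu_lim⟩ := exists_seq_strictAnti_tendsto t
  have key : ∀ n, ∃ C, MeasurableSet[natF (fun s (w : ℝ≥0 → E) => w s) (u n)] C ∧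
      B =ᵐ[μ] (fun ω s => Y s ω) ⁻¹' C := by
    intro n
    have h1 : natF Y (u n) ⊔ nullSets μ ≤ eventuallyMeasurableSpace (natF Y (u n)) (ae μ) :=
      sup_le le_eventuallyMeasurableSpace (nullSets_le_eventuallyMeasurableSpace _ μ)
    have h2 : rcF μ Y t ≤ natF Y (u n) ⊔ nullSets μ := iInf₂_le (u n) (hu_gt n)
    obtain ⟨S, hS, hBS⟩ := h1 _ (h2 _ hB)
    rw [natF_eq_comap] at hS
    obtain ⟨C, hC, rfl⟩ := hS
    exact ⟨C, hC, hBS⟩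
  choose C hC hBC using key
  refine ⟨limsup C atTop, ?_, ?_⟩
  · refine MeasurableSpace.measurableSet_iInf.2 fun v =>
      MeasurableSpace.measurableSet_iInf.2 fun hv => ?_
    obtain ⟨N, hN⟩ := (hu_lim.eventually_lt_const hv).exists
    rw [← limsup_nat_add C N]
    refine @MeasurableSet.measurableSet_limsup _ (natF _ v) _ fun n => ?_
    exact natF_mono _ ((hu_anti.antitone (Nat.le_add_left N n)).trans hN.le) _ (hC (n + N))
  · filter_upwards [ae_all_iff.2 hBC] with ω hω
    have hω' : ∀ n, ω ∈ B ↔ (fun s => Y s ω) ∈ C n := fun n => iff_of_eq (hω n)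
    refine propext ?_
    change ω ∈ B ↔ (fun s => Y s ω) ∈ limsup C atTop
    rw [mem_limsup_iff_frequently_mem]
    exact frequently_const.symm.trans (frequently_congr (.of_forall hω'))

lemma tendsto_floor_mul_add_one_div (s : ℝ≥0) :
    Tendsto (fun n : ℕ => ((⌊s * (n + 1)⌋₊ : ℝ≥0) + 1) / (n + 1)) atTop (𝓝[≥] s) := by
  have hge : ∀ n : ℕ, s ≤ ((⌊s * (n + 1)⌋₊ : ℝ≥0) + 1) / (n + 1) := fun n => by
    rw [le_div_iff₀ (by positivity)]
    exact (Nat.lt_floor_add_one _).le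
  have hle : ∀ n : ℕ, ((⌊s * (n + 1)⌋₊ : ℝ≥0) + 1) / (n + 1) ≤ s + 1 / ((n : ℝ≥0) + 1) :=
    fun n => by
      rw [div_le_iff₀ (by positivity), add_mul, one_div, inv_mul_cancel₀ (by positivity)]
      gcongr
      exact Nat.floor_le (by positivity)
  refine tendsto_nhdsWithin_iff.2 ⟨?_, .of_forall hge⟩
  refine tendsto_of_tendsto_of_tendsto_of_le_of_le tendsto_const_nhds ?_ hge hle
  simpa using (tendsto_const_nhds (x := s)).add
    (tendsto_one_div_add_atTop_nhds_zero_nat (𝕜 := ℝ≥0))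

lemma measurable_apply_nat {α β : Type*} [MeasurableSpace α] [MeasurableSpace β]
    {y : ℕ → α → β} (hy : ∀ s, Measurable (y s)) {k : α → ℕ} (hk : Measurable k) :
    Measurable fun a => y (k a) a :=
  (measurable_from_prod_countable_right (f := fun p : ℕ × α => y p.1 p.2) hy).comp
    (hk.prodMk measurable_id)

/-- Evaluating a right-continuous process at a measurable time is measurable. -/
lemma measurable_eval_of_rightContinuous {α : Type*} [MeasurableSpace α] {x : ℝ≥0 → α → ℝ}
    {τ : α → ℝ≥0} (hx : ∀ s, Measurable (x s))
    (hc : ∀ a s, ContinuousWithinAt (fun r => x r a) (Set.Ici s) s) (hτ : Measurable τ) :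
    Measurable fun a => x (τ a) a := by
  refine measurable_of_tendsto_metrizable
    (f := fun (n : ℕ) a => x (((⌊τ a * (n + 1)⌋₊ : ℝ≥0) + 1) / (n + 1)) a) (fun n => ?_)
    (tendsto_pi_nhds.2 fun a => (hc a (τ a)).tendsto.comp (tendsto_floor_mul_add_one_div (τ a)))
  exact measurable_apply_nat (y := fun k => x (((k : ℝ≥0) + 1) / (n + 1))) (fun _ => hx _)
    (hτ.mul_const _).nat_floor

/-- A real function that is measurable up to null sets with respect to `m.comap Φ` agrees almost
everywhere with an `m`-measurable function of `Φ`. -/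
lemma exists_measurable_comp_ae_eq [MeasurableSpace Ω] {μ : Measure Ω} {β : Type*}
    {m : MeasurableSpace β} {Φ : Ω → β} {A : Ω → ℝ}
    (hA : Measurable[eventuallyMeasurableSpace (m.comap Φ) (ae μ)] A) :
    ∃ H : β → ℝ, Measurable H ∧ A =ᵐ[μ] H ∘ Φ := by
  classical
  have key : ∀ q : ℚ, ∃ G, MeasurableSet G ∧ A ⁻¹' Set.Iio (q : ℝ) =ᵐ[μ] Φ ⁻¹' G := by
    intro q
    obtain ⟨S, ⟨G, hG, rfl⟩, hS⟩ := hA (measurableSet_Iio (a := (q : ℝ)))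
    exact ⟨G, hG, hS⟩
  choose G hG hAG using key
  refine ⟨fun p => (⨅ q : ℚ, if p ∈ G q then ((q : ℝ) : EReal) else ⊤).toReal,
    (Measurable.iInf fun q => Measurable.ite (hG q) measurable_const measurable_const).ereal_toReal,
    ?_⟩
  filter_upwards [ae_all_iff.2 hAG] with ω hω
  have hω' : ∀ q : ℚ, A ω < q ↔ Φ ω ∈ G q := fun q => iff_of_eq (hω q)
  have : (⨅ q : ℚ, if Φ ω ∈ G q then ((q : ℝ) : EReal) else ⊤) = (A ω : EReal) := by
    refine le_antisymm (le_of_forall_gt fun c hc => ?_) (le_iInf fun q => ?_)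
    · obtain ⟨q, hq, hqc⟩ := EReal.lt_iff_exists_rat_btwn.1 hc
      refine (iInf_le _ q).trans_lt ?_
      rwa [if_pos ((hω' q).1 (EReal.coe_lt_coe_iff.1 hq))]
    · split_ifs with h
      · exact EReal.coe_le_coe_iff.2 ((hω' q).2 h).le
      · exact le_top
  simp only [Function.comp_apply, this, EReal.toReal_coe]

lemma D.measurable_eval (s : ℝ≥0) : Measurable fun u : D => u.1 s :=
  measurable_iff_comap_le.2
    (le_iSup (fun s : ℝ≥0 => MeasurableSpace.comap (fun u : D => u.1 s) inferInstance) s)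

/-- The sub-σ-algebra of `D × D` consisting of the measurable sets whose sections along the paths
of `X` and `Z` have the adaptedness required at time `t`. -/
def sectionSigma [MeasurableSpace Ω] (μ : Measure Ω) (X : ℝ≥0 → Ω → ℝ) (Z : ℝ≥0 → Ω → ℝ≥0)
    (hX : ∀ ω, IsCadlag fun s => X s ω) (hZ : ∀ ω, IsCadlag fun s => (Z s ω : ℝ)) (t : ℝ≥0) :
    MeasurableSpace (D × D) :=
  inferInstance ⊓
    ((⨅ ω', (rcF μ Z t).map
        fun ω => (⟨fun s => X s ω', hX ω'⟩, ⟨fun s => (Z s ω : ℝ), hZ ω⟩)) ⊓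
      ⨅ ω', (rcF μ X (Z t ω')).map
        fun ω => (⟨fun s => X s ω, hX ω⟩, ⟨fun s => (Z s ω' : ℝ), hZ ω'⟩))

lemma measurable_sectionSigma [MeasurableSpace Ω] {μ : Measure Ω} {X : ℝ≥0 → Ω → ℝ}
    {Z : ℝ≥0 → Ω → ℝ≥0} {hX : ∀ ω, IsCadlag fun s => X s ω}
    {hZ : ∀ ω, IsCadlag fun s => (Z s ω : ℝ)} {t : ℝ≥0} {β : Type*} {mβ : MeasurableSpace β}
    {f : D × D → β} :
    Measurable[sectionSigma μ X Z hX hZ t] f ↔ Measurable f ∧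
      (∀ ω', Measurable[rcF μ Z t]
        fun ω => f (⟨fun s => X s ω', hX ω'⟩, ⟨fun s => (Z s ω : ℝ), hZ ω⟩)) ∧
      ∀ ω', Measurable[rcF μ X (Z t ω')]
        fun ω => f (⟨fun s => X s ω, hX ω⟩, ⟨fun s => (Z s ω' : ℝ), hZ ω'⟩) := by
  simp only [measurable_iff_comap_le, sectionSigma, le_inf_iff, le_iInf_iff,
    ← MeasurableSpace.comap_le_iff_le_map, MeasurableSpace.comap_comp, Function.comp_def]

lemma rcF_le_eventuallyMeasurableSpace [MeasurableSpace Ω] [MeasurableSpace E] {μ : Measure Ω}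
    {β : Type*} {m : MeasurableSpace β} {Φ : Ω → β} {t : ℝ≥0} {Y : ℝ≥0 → Ω → E} {f : β → ℝ≥0 → E}
    (hf : Measurable[m, pathF E t] f) (hY : ∀ ω s, f (Φ ω) s = Y s ω) :
    rcF μ Y t ≤ eventuallyMeasurableSpace (m.comap Φ) (ae μ) := by
  intro B hB
  obtain ⟨C, hC, hBC⟩ := exists_pathF_of_rcF hB
  refine ⟨Φ ⁻¹' (f ⁻¹' C), ⟨_, hf hC, rfl⟩, ?_⟩
  have : (fun ω s => Y s ω) = f ∘ Φ := by ext ω s; exact (hY ω s).symm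
  rwa [this] at hBC

section

variable [MeasurableSpace Ω] {μ : Measure Ω} {X : ℝ≥0 → Ω → ℝ} {Z : ℝ≥0 → Ω → ℝ≥0}
  (hX : ∀ ω, IsCadlag fun s => X s ω) (hZ : ∀ ω, IsCadlag fun s => (Z s ω : ℝ)) (t : ℝ≥0)

lemma measurable_time_sectionSigma : Measurable[sectionSigma μ X Z hX hZ t, pathF ℝ≥0 t]
    fun p s => (p.2.1 s).toNNReal := by
  refine measurable_sectionSigma.2 ⟨?_, fun ω' => ?_, fun ω' => ?_⟩
  · exact measurable_pathF (lt_add_one t) fun s _ =>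
      ((D.measurable_eval s).comp measurable_snd).real_toNNReal
  · refine measurable_rcF_of_forall_lt fun u hu => ?_
    simp only [Real.toNNReal_coe]
    exact measurable_pathF hu (natF_le_iff.1 le_rfl)
  · exact @measurable_const _ _ (pathF ℝ≥0 t) (rcF μ X (Z t ω')) fun s => (Z s ω' : ℝ).toNNReal

lemma measurable_timeChange_sectionSigma (hZmono : ∀ ω, Monotone fun s => Z s ω) :
    Measurable[sectionSigma μ X Z hX hZ t, pathF ℝ t]
      fun p s => p.1.1 (p.2.1 s).toNNReal := by
  refine measurable_sectionSigma.2 ⟨?_, fun ω' => ?_, fun ω' => ?_⟩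
  · exact measurable_pathF (lt_add_one t) fun s _ =>
      measurable_eval_of_rightContinuous (α := D × D) (x := fun r p => p.1.1 r)
        (fun r => (D.measurable_eval r).comp measurable_fst) (fun p => p.1.2.1)
        ((D.measurable_eval s).comp measurable_snd).real_toNNReal
  · refine measurable_rcF_of_forall_lt fun u hu => ?_
    simp only [Real.toNNReal_coe]
    refine measurable_pathF (Y := fun s ω => X (Z s ω) ω') hu fun s hs => ?_
    exact @measurable_eval_of_rightContinuous _ (natF Z u) (fun r _ => X r ω') (Z s)
      (fun _ => measurable_const) (fun _ => (hX ω').1) (natF_le_iff.1 le_rfl s hs)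
  · refine measurable_rcF_of_forall_lt fun v hv => ?_
    simp only [Real.toNNReal_coe]
    have hlim : Tendsto (fun s => Z s ω') (𝓝[>] t) (𝓝 (Z t ω')) :=
      NNReal.tendsto_coe.1 (((hZ ω').1 t).mono_left (nhdsWithin_mono _ Set.Ioi_subset_Ici_self))
    obtain ⟨u, huv, hu⟩ := ((hlim.eventually_lt_const hv).and self_mem_nhdsWithin).exists
    exact measurable_pathF (Y := fun s => X (Z s ω')) hu fun s hs =>
      natF_le_iff.1 le_rfl _ ((hZmono ω' hs).trans huv.le)

end

/-- Proposition 1, second claim, σ-algebra `ℱ_t`: here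
`ℱ^X_{Z_t(ω̃)}` is the σ-algebra `ℱ^X_s` at the deterministic time `s = Z_t(ω̃)`. -/
theorem stmt_3 [MeasurableSpace Ω] (μ : Measure Ω) [IsProbabilityMeasure μ] [μ.IsComplete]
    (X : ℝ≥0 → Ω → ℝ) (Z : ℝ≥0 → Ω → ℝ≥0)
    (hXmeas : ∀ s, Measurable (X s)) (hZmeas : ∀ s, Measurable (Z s))
    (hX : ∀ ω, IsCadlag fun s => X s ω)
    (hZ : ∀ ω, IsCadlag fun s => (Z s ω : ℝ))
    (hZmono : ∀ ω, Monotone fun s => Z s ω)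
    (hindep : ProbabilityTheory.Indep (sigmaProc X) (sigmaProc Z) μ)
    (t : ℝ≥0) (A : Ω → ℝ) (hA0 : ∀ ω, 0 ≤ A ω)
    (hA : Measurable[Ffilt μ X Z t] A) :
    ∃ H : D × D → ℝ, Measurable H ∧ (∀ p, 0 ≤ H p) ∧
      (∀ᵐ ω ∂μ, A ω = H (⟨fun s => X s ω, hX ω⟩, ⟨fun s => (Z s ω : ℝ), hZ ω⟩)) ∧
      (∀ᵐ ω' ∂μ, Measurable[rcF μ Z t]
        fun ω => H (⟨fun s => X s ω', hX ω'⟩, ⟨fun s => (Z s ω : ℝ), hZ ω⟩)) ∧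
      (∀ᵐ ω' ∂μ, Measurable[rcF μ X (Z t ω')]
        fun ω => H (⟨fun s => X s ω, hX ω⟩, ⟨fun s => (Z s ω' : ℝ), hZ ω'⟩)) := by
  have hle : Ffilt μ X Z t ≤ eventuallyMeasurableSpace ((sectionSigma μ X Z hX hZ t).comap
      fun ω => (⟨fun s => X s ω, hX ω⟩, ⟨fun s => (Z s ω : ℝ), hZ ω⟩)) (ae μ) :=
    sup_le (sup_le
      (rcF_le_eventuallyMeasurableSpace (measurable_timeChange_sectionSigma hX hZ t hZmono)
        fun ω s => by simp only [Real.toNNReal_coe])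
      (rcF_le_eventuallyMeasurableSpace (measurable_time_sectionSigma hX hZ t)
        fun ω s => by simp only [Real.toNNReal_coe]))
      (nullSets_le_eventuallyMeasurableSpace _ μ)
  obtain ⟨H, hH, hAH⟩ := exists_measurable_comp_ae_eq (hA.mono hle le_rfl)
  obtain ⟨h1, h2, h3⟩ := measurable_sectionSigma.1 hH
  refine ⟨fun p => max (H p) 0, h1.max measurable_const, fun p => le_max_right _ _, ?_,
    .of_forall fun ω' => (h2 ω').max measurable_const,
    .of_forall fun ω' => (h3 ω').max measurable_const⟩
  filter_upwards [hAH] with ω hω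
  exact (max_eq_left (hA0 ω)).symm.trans (congrArg (max · 0) hω)
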